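/- arXiv:2012.01090 — 2 statements merged into one kernel-verified Lean document; each statement's English description precedes it below -/
import Mathlib

section
/- Let B be a block of a connected graph G with |V(B)| = r ≥ 3 such that at most one vertex of B is a cut vertex of G. Let G' be the graph obtained from G by replacing the block B with the cycle C_r on the same vertex set V(B) (deleting all edges of B and adding the edges of a cycle through the vertices of B), in such a way that the cut vertices of G and of G' are the same. Then ε(G') ≥ ε(G). -/
open SimpleGraph

/-- The eccentricity of a vertex: maximum distance to any vertex. -/
noncomputable def ecc {V : Type*} (G : SimpleGraph V) (v : V) : ℕ :=
  ⨆ u, G.dist v u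

/-- The total eccentricity index: sum of eccentricities of all vertices. -/
noncomputable def totalEcc {V : Type*} [Fintype V] (G : SimpleGraph V) : ℕ :=
  ∑ v, ecc G v

/-- A pendant vertex: a vertex of degree one, i.e. with exactly one neighbour. -/
def IsPendant {V : Type*} (G : SimpleGraph V) (v : V) : Prop :=
  ∃! u, G.Adj v u

/-- A cut vertex: a vertex whose removal disconnects the graph. -/
def IsCutVertex {V : Type*} (G : SimpleGraph V) (w : V) : Prop :=
  ¬ (G.induce {v | v ≠ w}).Connected

/-- distance between two subgraphs -/
noncomputable def subgraphDist {V : Type*} (G : SimpleGraph V) (B B' : G.Subgraph) : ℕ :=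
  sInf {d | ∃ u ∈ B.verts, ∃ w ∈ B'.verts, G.dist u w = d}

/-- A 2-connected subgraph: at least two vertices, connected, and no cut vertex. -/
def TwoConn {V : Type*} {G : SimpleGraph V} (H : G.Subgraph) : Prop :=
  2 ≤ H.verts.ncard ∧ H.coe.Connected ∧ ∀ w, ¬ IsCutVertex H.coe w

/-- A block: a maximal 2-connected subgraph. -/
def IsBlock {V : Type*} {G : SimpleGraph V} (H : G.Subgraph) : Prop :=
  TwoConn H ∧ ∀ H' : G.Subgraph, H ≤ H' → TwoConn H' → H' = H

/-- A pendant block: a block containing exactly one cut vertex of `G`. -/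
def IsPendantBlock {V : Type*} (G : SimpleGraph V) (H : G.Subgraph) : Prop :=
  ∃! w, w ∈ H.verts ∧ IsCutVertex G w

/-- `G_{k,l}`: the graph obtained from `G` by attaching two new paths,
with `k` resp. `l` new vertices, at the vertex `v`. -/
def attachTwoPaths {V : Type*} (G : SimpleGraph V) (v : V) (k l : ℕ) :
    SimpleGraph (V ⊕ (Fin k ⊕ Fin l)) :=
  SimpleGraph.fromRel (fun p q =>
    match p, q with
    | .inl x, .inl y => G.Adj x y
    | .inl x, .inr (.inl i) => x = v ∧ i.val = 0
    | .inl x, .inr (.inr i) => x = v ∧ i.val = 0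
    | .inr (.inl i), .inr (.inl j) => i.val + 1 = j.val
    | .inr (.inr i), .inr (.inr j) => i.val + 1 = j.val
    | _, _ => False)

/-- The graph obtained from `H1`, `H2` and the path `P_d = v_1 v_2 … v_d` by identifying
`u ∈ V(H1)`, `v ∈ V(H2)` and `v_1` into a single vertex.  The `Fin (d-1)` part records the
path vertices `v_2, …, v_d`. -/
def glueMid {V1 V2 : Type*} (H1 : SimpleGraph V1) (H2 : SimpleGraph V2)
    (u : V1) (v : V2) (d : ℕ) :
    SimpleGraph (V1 ⊕ ({x : V2 // x ≠ v} ⊕ Fin (d - 1))) :=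
  SimpleGraph.fromRel (fun p q =>
    match p, q with
    | .inl x, .inl y => H1.Adj x y
    | .inl x, .inr (.inl y) => x = u ∧ H2.Adj v y.1
    | .inl x, .inr (.inr i) => x = u ∧ i.val = 0
    | .inr (.inl x), .inr (.inl y) => H2.Adj x.1 y.1
    | .inr (.inr i), .inr (.inr j) => i.val + 1 = j.val
    | _, _ => False)

/-- The graph obtained from `H1`, `H2` and the path `P_d = v_1 v_2 … v_d` by identifying
`u ∈ V(H1)` with `v_1` and `v ∈ V(H2)` with `v_d`.  The `Fin (d-1)` part records the path
vertices `v_2, …, v_d` (the last one being identified with `v`). -/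
def glueEnds {V1 V2 : Type*} (H1 : SimpleGraph V1) (H2 : SimpleGraph V2)
    (u : V1) (v : V2) (d : ℕ) :
    SimpleGraph (V1 ⊕ ({x : V2 // x ≠ v} ⊕ Fin (d - 1))) :=
  SimpleGraph.fromRel (fun p q =>
    match p, q with
    | .inl x, .inl y => H1.Adj x y
    | .inl x, .inr (.inr i) => x = u ∧ i.val = 0
    | .inr (.inl x), .inr (.inl y) => H2.Adj x.1 y.1
    | .inr (.inr i), .inr (.inl y) => i.val + 1 = d - 1 ∧ H2.Adj v y.1
    | .inr (.inr i), .inr (.inr j) => i.val + 1 = j.val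
    | _, _ => False)

/-- `U_{n,g}^l`: the unicyclic graph on `n` vertices obtained by joining one end vertex of
the path `P_{n-g}` to a vertex of the cycle `C_g` by an edge. -/
def UnlGraph (n g : ℕ) : SimpleGraph (Fin (n - g) ⊕ Fin g) :=
  SimpleGraph.fromRel (fun p q =>
    match p, q with
    | .inl i, .inl j => i.val + 1 = j.val
    | .inl i, .inr j => i.val + 1 = n - g ∧ j.val = 0
    | .inr i, .inr j => i.val + 1 = j.val ∨ (i.val = 0 ∧ j.val + 1 = g)
    | _, _ => False)

/-- `U_{n,g}^p`: the unicyclic graph on `n` vertices obtained by attaching `n - g` pendant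
vertices to one vertex of the cycle `C_g`. -/
def UnpGraph (n g : ℕ) : SimpleGraph (Fin g ⊕ Fin (n - g)) :=
  SimpleGraph.fromRel (fun p q =>
    match p, q with
    | .inl i, .inl j => i.val + 1 = j.val ∨ (i.val = 0 ∧ j.val + 1 = g)
    | .inl i, .inr _ => i.val = 0
    | _, _ => False)

/-- The graph obtained by joining the vertex `u` of `H` to the pendant vertex of
`U_{r,g}^l` by an edge. -/
def joinPendant {V : Type*} (H : SimpleGraph V) (u : V) (r g : ℕ) :
    SimpleGraph (V ⊕ (Fin (r - g) ⊕ Fin g)) :=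
  SimpleGraph.fromRel (fun p q =>
    match p, q with
    | .inl x, .inl y => H.Adj x y
    | .inl x, .inr (.inl i) => x = u ∧ i.val = 0
    | .inr a, .inr b => (UnlGraph r g).Adj a b
    | _, _ => False)

/-- `C_{m1,m2}^n` in the case `n = m1 + m2 - 1`: two cycles `C_{m1}` and `C_{m2}`
sharing exactly one vertex (the vertex `0`). -/
def twoCyclesGlued (m1 m2 : ℕ) : SimpleGraph (Fin (m1 + m2 - 1)) :=
  SimpleGraph.fromRel (fun i j =>
    (i.val + 1 = j.val ∧ j.val < m1) ∨ (i.val = 0 ∧ j.val + 1 = m1)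
    ∨ (i.val = 0 ∧ j.val = m1) ∨ (m1 ≤ i.val ∧ i.val + 1 = j.val)
    ∨ (i.val = 0 ∧ j.val + 2 = m1 + m2))

/-- `C_{3,3}^n` for `n > 5`: two triangles `{0,1,2}` and `{n-3,n-2,n-1}` joined by the path
`2, 3, …, n-3` (a path on `n - 4` vertices whose ends are identified with a vertex of each
triangle). -/
def C33 (n : ℕ) : SimpleGraph (Fin n) :=
  SimpleGraph.fromRel (fun i j =>
    (i.val = 0 ∧ j.val = 1) ∨ (i.val = 0 ∧ j.val = 2) ∨ (i.val = 1 ∧ j.val = 2)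
    ∨ (2 ≤ i.val ∧ i.val + 1 = j.val ∧ j.val + 3 ≤ n)
    ∨ (i.val + 3 = n ∧ j.val + 2 = n) ∨ (i.val + 2 = n ∧ j.val + 1 = n)
    ∨ (i.val + 3 = n ∧ j.val + 1 = n))

/-- `T(l, m, d)`: the tree obtained from the path `P_d` by attaching `l` pendant vertices at
one end and `m` pendant vertices at the other end. -/
def Tlmd (l m d : ℕ) : SimpleGraph (Fin d ⊕ (Fin l ⊕ Fin m)) :=
  SimpleGraph.fromRel (fun p q =>
    match p, q with
    | .inl i, .inl j => i.val + 1 = j.val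
    | .inl i, .inr (.inl _) => i.val = 0
    | .inl i, .inr (.inr _) => i.val + 1 = d
    | _, _ => False)

/-- `K_m^n(l_1, …, l_m)`: the graph obtained from the complete graph `K_m` by identifying,
for each `i`, one end vertex of a path on `l i` vertices with the `i`-th vertex of `K_m`.
The vertex `⟨i, 0⟩` is the `i`-th vertex of the complete graph. -/
def Kmn (m : ℕ) (l : Fin m → ℕ) : SimpleGraph ((i : Fin m) × Fin (l i)) :=
  SimpleGraph.fromRel (fun p q =>
    (p.1 = q.1 ∧ p.2.val + 1 = q.2.val) ∨ (p.1 ≠ q.1 ∧ p.2.val = 0 ∧ q.2.val = 0))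

/-- The graph obtained from `H`, `C_{m1}` and `C_{m2}` by identifying the vertex `w` of `H`,
a vertex of `C_{m1}` and a vertex of `C_{m2}` into one vertex. -/
def glueTwoCycles {V : Type*} (H : SimpleGraph V) (w : V) (m1 m2 : ℕ) :
    SimpleGraph (V ⊕ (Fin (m1 - 1) ⊕ Fin (m2 - 1))) :=
  SimpleGraph.fromRel (fun p q =>
    match p, q with
    | .inl x, .inl y => H.Adj x y
    | .inl x, .inr (.inl i) => x = w ∧ (i.val = 0 ∨ i.val + 2 = m1)
    | .inl x, .inr (.inr i) => x = w ∧ (i.val = 0 ∨ i.val + 2 = m2)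
    | .inr (.inl i), .inr (.inl j) => i.val + 1 = j.val
    | .inr (.inr i), .inr (.inr j) => i.val + 1 = j.val
    | _, _ => False)

/-- The graph obtained from `H` and the cycle `C_M` by identifying the vertex `w` of `H`
with one vertex of the cycle. -/
def glueOneCycle {V : Type*} (H : SimpleGraph V) (w : V) (M : ℕ) :
    SimpleGraph (V ⊕ Fin (M - 1)) :=
  SimpleGraph.fromRel (fun p q =>
    match p, q with
    | .inl x, .inl y => H.Adj x y
    | .inl x, .inr i => x = w ∧ (i.val = 0 ∨ i.val + 2 = M)
    | .inr i, .inr j => i.val + 1 = j.val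
    | _, _ => False)

namespace SimpleGraph

variable {V : Type*} {G : SimpleGraph V}

lemma Walk.le_add_length_of_lipschitz {φ : V → ℕ} (hφ : ∀ x y, G.Adj x y → φ y ≤ φ x + 1)
    {u v : V} (p : G.Walk u v) : φ v ≤ φ u + p.length := by
  induction p with
  | nil => simp
  | cons h p ih =>
    have := hφ _ _ h
    rw [Walk.length_cons]
    omega

lemma Connected.le_add_dist_of_lipschitz (hG : G.Connected) {φ : V → ℕ}
    (hφ : ∀ x y, G.Adj x y → φ y ≤ φ x + 1) (u v : V) : φ v ≤ φ u + G.dist u v := by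
  obtain ⟨p, hp⟩ := hG.exists_walk_length_eq_dist u v
  exact hp ▸ p.le_add_length_of_lipschitz hφ

lemma Connected.dist_le_dist_add_one (hG : G.Connected) (u : V) {x y : V} (h : G.Adj x y) :
    G.dist u y ≤ G.dist u x + 1 := by
  have := hG.dist_triangle (u := u) (v := x) (w := y)
  rwa [dist_eq_one_iff_adj.2 h] at this

/-- Discrete intermediate value theorem along a walk. -/
lemma Walk.exists_eq_of_lipschitz {φ : V → ℕ} (hφ : ∀ x y, G.Adj x y → φ y ≤ φ x + 1)
    {u v : V} (p : G.Walk u v) {k : ℕ} (hu : φ u ≤ k) (hv : k ≤ φ v) : ∃ x, φ x = k := by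
  induction p with
  | nil => exact ⟨_, le_antisymm hu hv⟩
  | @cons u x v h p ih =>
    have := hφ _ _ h
    rcases hu.eq_or_lt with hu | hu
    · exact ⟨_, hu⟩
    · exact ih (by omega) hv

lemma Reachable.induce_mono {s t : Set V} (hst : s ⊆ t) {x y : s}
    (h : (G.induce s).Reachable x y) :
    (G.induce t).Reachable ⟨x, hst x.2⟩ ⟨y, hst y.2⟩ :=
  h.map (G.induceHomOfLE hst).toHom

lemma Walk.reachable_induce {s : Set V} {x y : V} (p : G.Walk x y) (hp : ∀ z ∈ p.support, z ∈ s) :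
    (G.induce s).Reachable ⟨x, hp _ p.start_mem_support⟩ ⟨y, hp _ p.end_mem_support⟩ :=
  ⟨p.induce s hp⟩

end SimpleGraph

section Blocks

variable {V : Type*} {G : SimpleGraph V}

lemma TwoConn.connected_induce_diff {H : G.Subgraph} (hH : TwoConn H) {X : Set V}
    (hX : X.Subsingleton) : (G.induce (H.verts \ X)).Connected := by
  obtain ⟨-, hconn, hcut⟩ := hH
  by_cases h : ∃ w ∈ H.verts, w ∈ X
  · obtain ⟨w, hwH, hwX⟩ := h
    refine (not_not.1 (hcut ⟨w, hwH⟩)).map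
      (⟨fun x => ⟨x.1.1, x.1.2, fun hx => x.2 (Subtype.ext (hX hx hwX))⟩,
        fun hxy => H.adj_sub hxy⟩ :
        H.coe.induce {v | v ≠ ⟨w, hwH⟩} →g G.induce (H.verts \ X)) ?_
    rintro ⟨x, hx, hxX⟩
    exact ⟨⟨⟨x, hx⟩, fun h => hxX (by rw [show x = w from congrArg Subtype.val h]; exact hwX)⟩, rfl⟩
  · push Not at h
    refine hconn.map (⟨fun x => ⟨x.1, x.2, h _ x.2⟩, fun hxy => H.adj_sub hxy⟩ :
        H.coe →g G.induce (H.verts \ X)) ?_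
    rintro ⟨x, hx, hxX⟩
    exact ⟨⟨x, hx⟩, rfl⟩

lemma twoConn_induce_top {S : Set V} (hS : 2 ≤ S.ncard)
    (h : ∀ X : Set V, X.Subsingleton → (G.induce (S \ X)).Connected) :
    TwoConn ((⊤ : G.Subgraph).induce S) := by
  refine ⟨hS, ?_, fun w hw => hw ?_⟩
  · refine (h ∅ Set.subsingleton_empty).map
      (⟨fun x => ⟨x.1, x.2.1⟩, fun {x y} hxy => ⟨x.2.1, y.2.1, hxy⟩⟩ :
        G.induce (S \ ∅) →g ((⊤ : G.Subgraph).induce S).coe) ?_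
    rintro ⟨x, hx⟩
    exact ⟨⟨x, hx, Set.notMem_empty x⟩, rfl⟩
  · refine (h {w.1} Set.subsingleton_singleton).map
      (⟨fun x => ⟨⟨x.1, x.2.1⟩, fun hx => x.2.2 (congrArg Subtype.val hx)⟩,
        fun {x y} hxy => ⟨x.2.1, y.2.1, hxy⟩⟩ :
        G.induce (S \ {w.1}) →g ((⊤ : G.Subgraph).induce S).coe.induce {v | v ≠ w}) ?_
    rintro ⟨⟨x, hx⟩, hxw⟩
    exact ⟨⟨x, hx, fun hxw' => hxw (Subtype.ext hxw')⟩, rfl⟩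

/-- Adding to a 2-connected subgraph a path between two of its vertices preserves
2-connectedness. -/
lemma TwoConn.union_path [Finite V] {H : G.Subgraph} (hH : TwoConn H) {x z : V}
    (hx : x ∈ H.verts) (hz : z ∈ H.verts) (p : G.Walk x z) (hp : p.IsPath) :
    TwoConn ((⊤ : G.Subgraph).induce (H.verts ∪ {u | u ∈ p.support})) := by
  refine twoConn_induce_top
    (hH.1.trans (Set.ncard_le_ncard Set.subset_union_left (Set.toFinite _))) fun X hX => ?_
  have hconn := hH.connected_induce_diff hX
  obtain ⟨b, hb⟩ := hconn.nonempty
  have hsub : H.verts \ X ⊆ (H.verts ∪ {u | u ∈ p.support}) \ X :=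
    Set.sdiff_subset_sdiff_left Set.subset_union_left
  rw [connected_iff_exists_forall_reachable]
  refine ⟨⟨b, hsub hb⟩, ?_⟩
  have key : ∀ y (hy : y ∈ H.verts \ X),
      (G.induce ((H.verts ∪ {u | u ∈ p.support}) \ X)).Reachable ⟨b, hsub hb⟩ ⟨y, hsub hy⟩ :=
    fun y hy => (hconn.preconnected ⟨b, hb⟩ ⟨y, hy⟩).induce_mono hsub
  rintro ⟨u, huH | hup, huX⟩
  · exact key u ⟨huH, huX⟩
  · obtain ⟨q, t, hq, ht, hqt⟩ := hp.mem_support_iff_exists_append.1 hup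
    by_cases hqX : ∀ y ∈ q.support, y ∉ X
    · refine (key x ⟨hx, hqX x q.start_mem_support⟩).trans
        (q.reachable_induce fun y hy =>
          Set.mem_sdiff_of_mem (Or.inr (by simp [hqt, Walk.mem_support_append_iff, hy])) (hqX y hy))
    · push Not at hqX
      obtain ⟨a, haq, haX⟩ := hqX
      have htX : ∀ y ∈ t.support, y ∉ X := by
        intro y hy hyX
        obtain rfl := hX hyX haX
        exact (hqt ▸ hp).ne_of_mem_support_of_append (fun h => huX (h ▸ hyX)) haq hy rfl
      refine (key z ⟨hz, htX z t.end_mem_support⟩).trans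
        (t.reachable_induce fun y hy =>
          Set.mem_sdiff_of_mem (Or.inr (by simp [hqt, Walk.mem_support_append_iff, hy])) (htX y hy)).symm

lemma IsBlock.support_subset [Finite V] {H : G.Subgraph} (hH : IsBlock H) {x z : V}
    (hx : x ∈ H.verts) (hz : z ∈ H.verts) (p : G.Walk x z) (hp : p.IsPath)
    {u : V} (hu : u ∈ p.support) : u ∈ H.verts := by
  have h := hH.2 _ ?_ (hH.1.union_path hx hz p hp)
  · rw [← h]
    exact Or.inr hu
  · exact ⟨Set.subset_union_left, fun a b hab =>
      ⟨Or.inl (H.edge_vert hab), Or.inl (H.edge_vert hab.symm), H.adj_sub hab⟩⟩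

/-- A vertex of a block with a neighbour outside of the block is a cut vertex. -/
lemma IsBlock.isCutVertex_of_adj [Finite V] {H : G.Subgraph} (hH : IsBlock H) {x y : V}
    (hx : x ∈ H.verts) (hy : y ∉ H.verts) (hxy : G.Adj x y) : IsCutVertex G x := by
  classical
  intro hconn
  obtain ⟨z, hz, hzx⟩ := Set.exists_ne_of_one_lt_ncard (s := H.verts) hH.1.1 x
  obtain ⟨q, hq⟩ := (hconn.preconnected ⟨y, hxy.ne'⟩ ⟨z, hzx⟩).exists_isPath
  let q' : G.Walk y z := q.map (Embedding.induce {v | v ≠ x}).toHom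
  have hq' : q'.IsPath := hq.map Subtype.val_injective
  have hxq : x ∉ q'.support := by
    intro hxq
    obtain ⟨a, -, ha⟩ := List.mem_map.1 (Walk.support_map _ q ▸ hxq)
    exact a.2 ha
  exact hy (hH.support_subset hx hz _ (hq'.cons hxq (h := hxy)) (by simp))

end Blocks

section Counting

open Finset

lemma Finset.sum_le_sum_of_card_lt_le {ι : Type*} (s : Finset ι) (f g : ι → ℕ)
    (h : ∀ k, #{i ∈ s | k < f i} ≤ #{i ∈ s | k < g i}) : ∑ i ∈ s, f i ≤ ∑ i ∈ s, g i := by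
  obtain ⟨N, hN⟩ : ∃ N, ∀ i ∈ s, f i ≤ N ∧ g i ≤ N :=
    ⟨s.sup f + s.sup g, fun i hi => ⟨(Finset.le_sup hi).trans (Nat.le_add_right _ _),
      (Finset.le_sup hi).trans (Nat.le_add_left _ _)⟩⟩
  have key : ∀ e : ι → ℕ, (∀ i ∈ s, e i ≤ N) →
      ∑ i ∈ s, e i = ∑ k ∈ range N, #{i ∈ s | k < e i} := by
    intro e he
    refine Eq.trans ?_
      (sum_card_bipartiteAbove_eq_sum_card_bipartiteBelow (s := s) (fun i k => k < e i))
    refine sum_congr rfl fun i hi => ?_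
    have : bipartiteAbove (fun i k => k < e i) (range N) i = range (e i) := by
      ext k
      have := he i hi
      simp only [bipartiteAbove, mem_filter, mem_range]
      omega
    rw [this, card_range]
  rw [key f fun i hi => (hN i hi).1, key g fun i hi => (hN i hi).2]
  exact sum_le_sum fun k _ => h k

lemma Finset.sum_max_add_le {ι : Type*} (s : Finset ι) (f g : ι → ℕ)
    (h : ∀ k, 1 ≤ k → #{i ∈ s | k ≤ f i} ≤ #{i ∈ s | k ≤ g i}) (a b : ℕ) :
    ∑ i ∈ s, max a (f i + b) ≤ ∑ i ∈ s, max a (g i + b) := by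
  refine s.sum_le_sum_of_card_lt_le _ _ fun k => ?_
  by_cases hk : k < a ∨ k < b
  · refine card_le_card fun i hi => ?_
    simp only [mem_filter] at hi ⊢
    exact ⟨hi.1, by omega⟩
  · have hiff : ∀ n, k < max a (n + b) ↔ k + 1 - b ≤ n := fun n => by omega
    simp only [hiff]
    exact h _ (by omega)

/-- In a 2-connected subgraph, there are two vertices on each level strictly between a vertex and
another vertex. -/
lemma TwoConn.two_mul_sub_one_le_card {V : Type*} {G : SimpleGraph V} (hG : G.Connected)
    {H : G.Subgraph} [Fintype H.verts] (hH : TwoConn H) (u v : H.verts) {k : ℕ} (hk : 1 ≤ k)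
    (hkv : k ≤ G.dist u v) : 2 * k - 1 ≤ #{x : H.verts | G.dist u x < k} := by
  classical
  induction k, hk using Nat.le_induction with
  | base => exact card_pos.2 ⟨u, by simp⟩
  | succ k hk ih =>
    have hex : ∀ X : Set V, X.Subsingleton → u.1 ∉ X → v.1 ∉ X →
        ∃ x : H.verts, x.1 ∉ X ∧ G.dist u x = k := by
      intro X hX hu hv
      obtain ⟨p⟩ := (hH.connected_induce_diff hX).preconnected ⟨u, u.2, hu⟩ ⟨v, v.2, hv⟩
      obtain ⟨x, hx⟩ := p.exists_eq_of_lipschitz (φ := fun x => G.dist u x.1) (k := k)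
        (fun x y hxy => hG.dist_le_dist_add_one _ hxy) (by simp) (Nat.le_of_succ_le hkv)
      exact ⟨⟨x, x.2.1⟩, x.2.2, hx⟩
    obtain ⟨x, -, hx⟩ := hex ∅ Set.subsingleton_empty (by simp) (by simp)
    obtain ⟨y, hyx, hy⟩ := hex {x.1} Set.subsingleton_singleton
      (by
        rintro (h : u.1 = x.1)
        rw [← h, SimpleGraph.dist_self] at hx
        omega)
      (by
        rintro (h : v.1 = x.1)
        rw [h] at hkv
        omega)
    have hsub : ({x : H.verts | G.dist u x < k} : Finset H.verts) ∪ {x, y} ⊆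
        ({x : H.verts | G.dist u x < k + 1} : Finset H.verts) := by
      intro z hz
      simp only [mem_union, mem_filter, mem_univ, true_and, mem_insert, mem_singleton] at hz ⊢
      rcases hz with hz | rfl | rfl <;> omega
    have hdisj : Disjoint ({x : H.verts | G.dist u x < k} : Finset H.verts) {x, y} := by
      rw [Finset.disjoint_left]
      intro z hz
      simp only [mem_filter, mem_univ, true_and, mem_insert, mem_singleton] at hz ⊢
      rintro (rfl | rfl) <;> omega
    have hxy : x ≠ y := fun h => hyx (by simp [h])
    have := card_le_card hsub
    rw [card_union_of_disjoint hdisj, card_pair hxy] at this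
    have := ih (by omega)
    omega

lemma TwoConn.two_mul_dist_le_card {V : Type*} {G : SimpleGraph V} (hG : G.Connected)
    {H : G.Subgraph} [Fintype H.verts] (hH : TwoConn H) (u v : H.verts) :
    2 * G.dist u v ≤ Fintype.card H.verts := by
  rcases Nat.eq_zero_or_pos (G.dist u v) with h | h
  · simp [h]
  · have h1 := hH.two_mul_sub_one_le_card hG u v h le_rfl
    have h2 : #{x : H.verts | G.dist u x < G.dist u v} < #(univ : Finset H.verts) :=
      card_lt_card (by
        rw [Finset.ssubset_univ_iff]
        intro h
        have := h ▸ mem_univ v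
        simp at this)
    rw [card_univ] at h2
    omega

lemma SimpleGraph.Walk.exists_int_of_cycleGraph {n : ℕ} {u v : Fin n}
    (p : (cycleGraph n).Walk u v) :
    ∃ a : ℤ, |a| ≤ p.length ∧ (v : ℤ) ≡ u + a [ZMOD n] := by
  induction p with
  | nil => exact ⟨0, by simp⟩
  | @cons u x v h p ih =>
    obtain ⟨a, ha, hav⟩ := ih
    have hstep : ∃ e : ℤ, |e| ≤ 1 ∧ (x : ℤ) ≡ u + e [ZMOD n] := by
      rcases cycleGraph_adj'.1 h with h | h
      · refine ⟨-1, by simp, ?_⟩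
        rw [Int.modEq_iff_dvd]
        rw [Fin.val_sub] at h
        have h1 := Nat.div_add_mod (n - x.1 + u.1) n
        rw [h] at h1
        have := x.2
        refine ⟨((n - x.1 + u.1) / n : ℕ) - 1, ?_⟩
        rw [mul_sub]
        zify [this.le] at h1
        push_cast
        rw [Nat.cast_sub this.le]
        linarith
      · refine ⟨1, by simp, ?_⟩
        rw [Int.modEq_iff_dvd]
        rw [Fin.val_sub] at h
        have h1 := Nat.div_add_mod (n - u.1 + x.1) n
        rw [h] at h1
        have := u.2
        refine ⟨1 - ((n - u.1 + x.1) / n : ℕ), ?_⟩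
        rw [mul_sub]
        zify [this.le] at h1
        push_cast
        rw [Nat.cast_sub this.le]
        linarith
    obtain ⟨e, he, hex⟩ := hstep
    refine ⟨e + a, ?_, ?_⟩
    · rw [Walk.length_cons]
      push_cast
      linarith [abs_add_le e a]
    · rw [← add_assoc]
      exact hav.trans (hex.add_right a)

lemma card_dist_lt_cycleGraph_le {W : Type*} [Fintype W] {C : SimpleGraph W} {n : ℕ}
    (e : C ≃g cycleGraph n) (u : W) {k : ℕ} (hk : 1 ≤ k) :
    #{x | C.dist u x < k} ≤ 2 * k - 1 := by
  classical
  have hconn : C.Preconnected := e.preconnected_iff.2 cycleGraph_preconnected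
  let F : ℤ → ℤ := fun a => ((e u : ℕ) + a) % n
  have hcard : #((Finset.Icc (-(k - 1 : ℤ)) (k - 1)).image F) ≤ 2 * k - 1 := by
    refine card_image_le.trans ?_
    rw [Int.card_Icc]
    omega
  refine le_trans ?_ hcard
  refine card_le_card_of_injOn (fun x => ((e x : ℕ) : ℤ)) ?_ ?_
  · intro x hx
    simp only [coe_filter, mem_univ, true_and, Set.mem_ofPred_eq] at hx
    obtain ⟨p, hp⟩ := (hconn u x).exists_walk_length_eq_dist
    obtain ⟨a, ha, hax⟩ := (p.map e.toHom).exists_int_of_cycleGraph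
    rw [Walk.length_map, hp, abs_le] at ha
    simp only [coe_image, Set.mem_image, coe_Icc, Set.mem_Icc]
    refine ⟨a, ⟨by omega, by omega⟩, ?_⟩
    have hlt := (e x).2
    have h0 : ((e x : ℕ) : ℤ) % n = (e x : ℕ) :=
      Int.emod_eq_of_lt (by positivity) (by exact_mod_cast hlt)
    exact Eq.trans (Int.ModEq.symm hax) h0
  · intro x _ y _ hxy
    exact e.injective (Fin.ext (Int.ofNat_inj.1 hxy))

lemma exists_card_le_dist_of_cycleGraph {W : Type*} [Fintype W] {C : SimpleGraph W} {n : ℕ}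
    (e : C ≃g cycleGraph n) (u : W) : ∃ v, n / 2 ≤ C.dist u v := by
  rcases Nat.eq_zero_or_pos (n / 2) with h | h
  · exact ⟨u, by omega⟩
  · by_contra! hlt
    have := card_dist_lt_cycleGraph_le e u h
    rw [filter_true_of_mem fun x _ => hlt x, card_univ, Fintype.card_congr e.toEquiv,
      Fintype.card_fin] at this
    omega

end Counting

lemma dist_le_ecc {V : Type*} [Finite V] (G : SimpleGraph V) (u v : V) : G.dist u v ≤ ecc G u :=
  le_ciSup (f := fun v => G.dist u v) (Set.finite_range _).bddAbove v

lemma ecc_le {V : Type*} {G : SimpleGraph V} {u : V} {n : ℕ} (h : ∀ v, G.dist u v ≤ n) :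
    ecc G u ≤ n :=
  haveI : Nonempty V := ⟨u⟩
  ciSup_le h

section Replace

variable {V : Type*} {G G' : SimpleGraph V} {S : Set V} {w : V}

lemma connected_of_replace (hG : G.Connected)
    (houtside : ∀ x y : V, ¬ (x ∈ S ∧ y ∈ S) → (G'.Adj x y ↔ G.Adj x y))
    (hS : (G'.induce S).Preconnected) : G'.Connected := by
  have hadj : ∀ x y, G.Adj x y → G'.Reachable x y := by
    intro x y hxy
    by_cases h : x ∈ S ∧ y ∈ S
    · exact (hS ⟨x, h.1⟩ ⟨y, h.2⟩).map (Embedding.induce S).toHom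
    · exact ((houtside x y h).2 hxy).reachable
  have := hG.nonempty
  refine ⟨fun x y => ?_⟩
  obtain ⟨p⟩ := hG.preconnected x y
  induction p with
  | nil => exact Reachable.refl _
  | cons h p ih => exact (hadj _ _ h).trans ih

open Classical in
/-- If `S` is attached to the rest of the graph at the single vertex `w`, then functions on `S` and
on the vertices outside of `S` that change by at most one along edges and agree at `w` can be glued
to such a function on the graph obtained by replacing the part of `G` on `S`. -/
lemma lipschitz_of_replace (hw : w ∈ S)
    (houtside : ∀ x y : V, ¬ (x ∈ S ∧ y ∈ S) → (G'.Adj x y ↔ G.Adj x y))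
    (hatt : ∀ x ∈ S, ∀ y ∉ S, G.Adj x y → x = w) (f : S → ℕ) (g : V → ℕ)
    (hf : ∀ x y, (G'.induce S).Adj x y → f y ≤ f x + 1)
    (hg : ∀ x y, G.Adj x y → g y ≤ g x + 1) (hfg : f ⟨w, hw⟩ = g w) (x y : V)
    (hxy : G'.Adj x y) :
    (if h : y ∈ S then f ⟨y, h⟩ else g y) ≤ (if h : x ∈ S then f ⟨x, h⟩ else g x) + 1 := by
  by_cases hx : x ∈ S <;> by_cases hy : y ∈ S
  · simpa [hx, hy] using hf ⟨x, hx⟩ ⟨y, hy⟩ hxy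
  · have h := (houtside x y (by tauto)).1 hxy
    obtain rfl := hatt x hx y hy h
    simpa [hx, hy, hfg] using hg _ _ h
  · have h := (houtside x y (by tauto)).1 hxy
    obtain rfl := hatt y hy x hx h.symm
    simpa [hx, hy, hfg] using hg _ _ h
  · simpa [hx, hy] using hg _ _ ((houtside x y (by tauto)).1 hxy)

end Replace

-- STATEMENT 4
theorem stmt4 {V : Type*} [Fintype V] (G : SimpleGraph V) (hG : G.Connected)
    (B : G.Subgraph) (hB : IsBlock B) (r : ℕ) (hr : 3 ≤ r) (hcard : B.verts.ncard = r)
    (hcutB : ({w ∈ B.verts | IsCutVertex G w}).ncard ≤ 1)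
    (G' : SimpleGraph V)
    (houtside : ∀ x y : V, ¬ (x ∈ B.verts ∧ y ∈ B.verts) → (G'.Adj x y ↔ G.Adj x y))
    (hcycle : Nonempty (G'.induce B.verts ≃g cycleGraph r))
    (hcutsame : ∀ w, IsCutVertex G' w ↔ IsCutVertex G w) :
    totalEcc G ≤ totalEcc G' := by
  classical
  have hcardB : Fintype.card B.verts = r := by
    rw [← hcard, ← Nat.card_coe_set_eq, Nat.card_eq_fintype_card]
  obtain ⟨w, hw, hwcut⟩ : ∃ w ∈ B.verts, ∀ x ∈ B.verts, IsCutVertex G x → x = w := by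
    rcases ({w ∈ B.verts | IsCutVertex G w}).eq_empty_or_nonempty with h | ⟨w, hw⟩
    · obtain ⟨w, hw⟩ := Set.nonempty_of_ncard_ne_zero (s := B.verts) (by omega)
      exact ⟨w, hw, fun x hx hxc => absurd ⟨hx, hxc⟩ (Set.eq_empty_iff_forall_notMem.1 h x)⟩
    · exact ⟨w, hw.1, fun x hx hxc => (Set.ncard_le_one (Set.toFinite _)).1 hcutB _ ⟨hx, hxc⟩ _ hw⟩
  have hatt : ∀ x ∈ B.verts, ∀ y ∉ B.verts, G.Adj x y → x = w :=
    fun x hx y hy hxy => hwcut x hx (hB.isCutVertex_of_adj hx hy hxy)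
  obtain ⟨e⟩ := hcycle
  have hCpre : (G'.induce B.verts).Preconnected := e.preconnected_iff.2 cycleGraph_preconnected
  have : Nonempty B.verts := ⟨⟨w, hw⟩⟩
  have hC : (G'.induce B.verts).Connected := ⟨hCpre⟩
  have hG' : G'.Connected := connected_of_replace hG houtside hCpre
  have hhalf : ∀ u v : B.verts, G.dist u v ≤ r / 2 := fun u v => by
    have := hB.1.two_mul_dist_le_card hG u v
    omega
  have hout : ∀ v, v ∉ B.verts → ∀ x, (if h : x ∈ B.verts
      then G.dist v w + (G'.induce B.verts).dist ⟨w, hw⟩ ⟨x, h⟩ else G.dist v x) ≤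
        G'.dist v x := by
    intro v hv x
    have := hG'.le_add_dist_of_lipschitz (lipschitz_of_replace hw houtside hatt
      (fun x => G.dist v w + (G'.induce B.verts).dist ⟨w, hw⟩ x) (fun x => G.dist v x)
      (fun x y hxy => by linarith [hC.dist_le_dist_add_one ⟨w, hw⟩ hxy])
      (fun x y hxy => hG.dist_le_dist_add_one _ hxy) (by simp)) v x
    simpa [hv] using this
  have hin : ∀ v (hv : v ∈ B.verts) x, (if h : x ∈ B.verts
      then (G'.induce B.verts).dist ⟨v, hv⟩ ⟨x, h⟩
      else (G'.induce B.verts).dist ⟨v, hv⟩ ⟨w, hw⟩ + G.dist w x) ≤ G'.dist v x := by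
    intro v hv x
    have := hG'.le_add_dist_of_lipschitz (lipschitz_of_replace hw houtside hatt
      (fun x => (G'.induce B.verts).dist ⟨v, hv⟩ x)
      (fun x => (G'.induce B.verts).dist ⟨v, hv⟩ ⟨w, hw⟩ + G.dist w x)
      (fun x y hxy => hC.dist_le_dist_add_one _ hxy)
      (fun x y hxy => by linarith [hG.dist_le_dist_add_one w hxy]) (by simp)) v x
    simpa [hv] using this
  unfold totalEcc
  rw [← Fintype.sum_subtype_add_sum_subtype (· ∈ B.verts) (fun v => ecc G v),
    ← Fintype.sum_subtype_add_sum_subtype (· ∈ B.verts) (fun v => ecc G' v)]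
  refine add_le_add ?_ (Finset.sum_le_sum ?_)
  · obtain ⟨x₀, hx₀, hmax⟩ := Set.exists_max_image {x | x ∉ B.verts ∨ x = w}
      (fun x => G.dist w x) (Set.toFinite _) ⟨w, Or.inr rfl⟩
    calc ∑ v : B.verts, ecc G v
        ≤ ∑ v : B.verts, max (r / 2) (G.dist w v + G.dist w x₀) := by
          refine Finset.sum_le_sum fun v _ => ecc_le fun x => ?_
          by_cases hx : x ∈ B.verts
          · exact le_max_of_le_left (hhalf v ⟨x, hx⟩)
          · refine le_max_of_le_right ((hG.dist_triangle (v := w)).trans ?_)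
            rw [SimpleGraph.dist_comm]
            exact Nat.add_le_add_left (hmax x (Or.inl hx)) _
      _ ≤ ∑ v : B.verts, max (r / 2) ((G'.induce B.verts).dist ⟨w, hw⟩ v + G.dist w x₀) := by
          refine Finset.sum_max_add_le _ _ _ (fun k hk => ?_) _ _
          have h1 := card_dist_lt_cycleGraph_le e ⟨w, hw⟩ hk
          have h2 := Finset.card_filter_add_card_filter_not (s := Finset.univ)
            (fun v : B.verts => (G'.induce B.verts).dist ⟨w, hw⟩ v < k)
          have h3 := Finset.card_filter_add_card_filter_not (s := Finset.univ)
            (fun v : B.verts => G.dist w v < k)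
          simp only [not_lt] at h2 h3
          rcases Finset.eq_empty_or_nonempty ({v : B.verts | k ≤ G.dist w v} : Finset B.verts)
            with h | ⟨v, hv⟩
          · simp [h]
          · have h4 := hB.1.two_mul_sub_one_le_card hG ⟨w, hw⟩ v hk (Finset.mem_filter.1 hv).2
            simp only at h4
            omega
      _ ≤ ∑ v : B.verts, ecc G' v := by
          refine Finset.sum_le_sum fun v _ => max_le ?_ ?_
          · obtain ⟨u, hu⟩ := exists_card_le_dist_of_cycleGraph e v
            have := hin v v.2 u
            simp only [u.2, dite_true] at this
            exact hu.trans (this.trans (dist_le_ecc _ _ _))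
          · have := hin v v.2 x₀
            refine le_trans ?_ (this.trans (dist_le_ecc _ _ _))
            rw [SimpleGraph.dist_comm]
            rcases hx₀ with hx₀ | rfl
            · simp [hx₀]
            · simp [hw]
  · rintro ⟨v, hv⟩ -
    refine ecc_le fun x => ?_
    by_cases hx : x ∈ B.verts
    · obtain ⟨u, hu⟩ := exists_card_le_dist_of_cycleGraph e ⟨w, hw⟩
      have h1 := hout v hv u
      rw [dif_pos u.2] at h1
      have h2 := hG.dist_triangle (u := v) (v := w) (w := x)
      have h3 := hhalf ⟨w, hw⟩ ⟨x, hx⟩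
      have h4 := dist_le_ecc G' v u
      simp only [Subtype.coe_eta] at h1 h3 ⊢
      omega
    · have h1 := hout v hv x
      simp only [hx, dite_false] at h1
      exact h1.trans (dist_le_ecc _ _ _)
end

section
/- Let m ≥ 2 and let l_1,…,l_m be positive integers with l_1+⋯+l_m = n. Suppose l_k = max{l_1,…,l_m} and l_j ≤ l_k − 2 for some index j ≠ k. Then ε(K_m^n(l_1,…,l_j+1,…,l_k−1,…,l_m)) ≤ ε(K_m^n(l_1,…,l_m)). -/
open SimpleGraph

/-- The distance between two vertices of `Kmn m l`. -/
def kmnDist {m : ℕ} {l : Fin m → ℕ} (p q : (i : Fin m) × Fin (l i)) : ℕ :=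
  if p.1 = q.1 then (p.2.val - q.2.val) + (q.2.val - p.2.val) else p.2.val + q.2.val + 1

/-- The largest number of vertices on a path attached at a clique vertex other than the `i`-th. -/
def otherMax {m : ℕ} (l : Fin m → ℕ) (i : Fin m) : ℕ :=
  (Finset.univ.erase i).sup l

/-- The eccentricity of the vertex of `Kmn m l` at height `a` on the `i`-th path. -/
def kmnEcc {m : ℕ} (l : Fin m → ℕ) (i : Fin m) (a : ℕ) : ℕ :=
  max (l i - 1 - a) (a + otherMax l i)

theorem le_otherMax {m : ℕ} (l : Fin m → ℕ) {i i' : Fin m} (h : i' ≠ i) :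
    l i' ≤ otherMax l i :=
  Finset.le_sup (f := l) (by simp [h])

theorem otherMax_le {m : ℕ} {l : Fin m → ℕ} {i : Fin m} {c : ℕ}
    (h : ∀ i', i' ≠ i → l i' ≤ c) : otherMax l i ≤ c :=
  Finset.sup_le fun i' hi' => h i' (Finset.ne_of_mem_erase hi')

theorem kmn_adj {m : ℕ} {l : Fin m → ℕ} {p q : (i : Fin m) × Fin (l i)} :
    (Kmn m l).Adj p q ↔ (p.1 = q.1 ∧ (p.2.val + 1 = q.2.val ∨ q.2.val + 1 = p.2.val)) ∨
      (p.1 ≠ q.1 ∧ p.2.val = 0 ∧ q.2.val = 0) := by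
  obtain ⟨i, a⟩ := p
  obtain ⟨i', b⟩ := q
  simp only [Kmn, SimpleGraph.fromRel_adj, ne_eq]
  constructor
  · rintro ⟨-, (⟨h, h'⟩ | ⟨h, h', h''⟩) | (⟨h, h'⟩ | ⟨h, h', h''⟩)⟩
    · exact Or.inl ⟨h, Or.inl h'⟩
    · exact Or.inr ⟨h, h', h''⟩
    · exact Or.inl ⟨h.symm, Or.inr h'⟩
    · exact Or.inr ⟨fun e => h e.symm, h'', h'⟩
  · rintro (⟨h, h'⟩ | ⟨h, h', h''⟩)
    · refine ⟨fun e => ?_, ?_⟩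
      · subst h
        rw [Sigma.mk.injEq] at e
        have := congrArg Fin.val (eq_of_heq e.2)
        omega
      · rcases h' with h' | h'
        · exact Or.inl (Or.inl ⟨h, h'⟩)
        · exact Or.inr (Or.inl ⟨h.symm, h'⟩)
    · exact ⟨fun e => h (congrArg Sigma.fst e), Or.inl (Or.inr ⟨h, h', h''⟩)⟩

theorem kmnDist_le_length {m : ℕ} {l : Fin m → ℕ} {p q : (i : Fin m) × Fin (l i)}
    (w : (Kmn m l).Walk p q) : kmnDist p q ≤ w.length := by
  induction w with
  | nil => simp [kmnDist]
  | @cons u v w h p ih =>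
    rw [SimpleGraph.Walk.length_cons]
    rw [kmn_adj] at h
    unfold kmnDist at *
    rcases h with ⟨h, h'⟩ | ⟨h, h', h''⟩
    · simp only [h]
      split_ifs at * <;> omega
    · split_ifs at * with h1 h2 h2
      · exact absurd (h1.trans h2.symm) h
      all_goals omega

theorem kmn_exists_walk_up {m : ℕ} {l : Fin m → ℕ} (i : Fin m) {a b : ℕ} (hab : a ≤ b)
    (hb : b < l i) :
    ∃ w : (Kmn m l).Walk ⟨i, ⟨a, hab.trans_lt hb⟩⟩ ⟨i, ⟨b, hb⟩⟩, w.length = b - a := by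
  induction b, hab using Nat.le_induction with
  | base => exact ⟨.nil, by simp⟩
  | succ b hab ih =>
    obtain ⟨w, hw⟩ := ih (by omega)
    refine ⟨w.concat (kmn_adj.2 (Or.inl ⟨rfl, Or.inl rfl⟩)), ?_⟩
    rw [SimpleGraph.Walk.length_concat, hw]
    omega

theorem kmn_exists_walk {m : ℕ} {l : Fin m → ℕ} (p q : (i : Fin m) × Fin (l i)) :
    ∃ w : (Kmn m l).Walk p q, w.length = kmnDist p q := by
  obtain ⟨i, a, ha⟩ := p
  obtain ⟨i', b, hb⟩ := q
  by_cases h : i = i'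
  · subst h
    rcases le_total a b with hab | hab
    · obtain ⟨w, hw⟩ := kmn_exists_walk_up i hab hb
      exact ⟨w, by simp [kmnDist, hw, hab]⟩
    · obtain ⟨w, hw⟩ := kmn_exists_walk_up i hab ha
      exact ⟨w.reverse, by simp [kmnDist, hw, hab]⟩
  · obtain ⟨w, hw⟩ := kmn_exists_walk_up i a.zero_le ha
    obtain ⟨w', hw'⟩ := kmn_exists_walk_up i' b.zero_le hb
    refine ⟨w.reverse.append (.cons (kmn_adj.2 (Or.inr ⟨h, rfl, rfl⟩)) w'), ?_⟩
    simp [kmnDist, h, hw, hw', add_assoc]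

theorem kmn_dist {m : ℕ} {l : Fin m → ℕ} (p q : (i : Fin m) × Fin (l i)) :
    (Kmn m l).dist p q = kmnDist p q := by
  obtain ⟨w, hw⟩ := kmn_exists_walk p q
  obtain ⟨w', hw'⟩ := w.reachable.exists_walk_length_eq_dist
  exact le_antisymm (hw ▸ SimpleGraph.dist_le w) (hw' ▸ kmnDist_le_length w')

theorem ecc_kmn {m : ℕ} (hm : 2 ≤ m) {l : Fin m → ℕ} (hpos : ∀ i, 1 ≤ l i)
    (i : Fin m) (a : Fin (l i)) : ecc (Kmn m l) ⟨i, a⟩ = kmnEcc l i a := by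
  have : Nonempty ((i : Fin m) × Fin (l i)) := ⟨⟨i, a⟩⟩
  have ha := a.2
  have lower : ∀ q, kmnDist ⟨i, a⟩ q ≤ ecc (Kmn m l) ⟨i, a⟩ := fun q =>
    kmn_dist (⟨i, a⟩ : (i : Fin m) × Fin (l i)) q ▸
      le_ciSup (f := fun u => (Kmn m l).dist ⟨i, a⟩ u) (Set.finite_range _).bddAbove q
  apply le_antisymm
  · refine ciSup_le fun q => ?_
    rw [kmn_dist]
    obtain ⟨i', b⟩ := q
    have hb := b.2
    unfold kmnDist kmnEcc
    split_ifs with h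
    · dsimp only at h
      subst h
      dsimp only
      omega
    · have := le_otherMax l (fun e => h e.symm : i' ≠ i)
      dsimp only
      omega
  · refine max_le ?_ ?_
    · have := lower ⟨i, ⟨l i - 1, by omega⟩⟩
      simp only [kmnDist, if_true] at this
      omega
    · have : Nontrivial (Fin m) := Fin.nontrivial_iff_two_le.2 hm
      obtain ⟨i₀, hi₀⟩ := exists_ne i
      obtain ⟨i', hi', e⟩ := Finset.exists_mem_eq_sup (Finset.univ.erase i)
        ⟨i₀, by simp [hi₀]⟩ l
      have hne := Finset.ne_of_mem_erase hi'
      have hp := hpos i'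
      have := lower ⟨i', ⟨l i' - 1, by omega⟩⟩
      simp only [kmnDist, if_neg hne.symm] at this
      unfold otherMax
      omega

theorem totalEcc_kmn {m : ℕ} (hm : 2 ≤ m) {l : Fin m → ℕ} (hpos : ∀ i, 1 ≤ l i) :
    totalEcc (Kmn m l) = ∑ i, ∑ a ∈ Finset.range (l i), kmnEcc l i a := by
  rw [totalEcc, Fintype.sum_sigma]
  refine Finset.sum_congr rfl fun i _ => ?_
  rw [Finset.sum_range]
  exact Finset.sum_congr rfl fun a _ => ecc_kmn hm hpos i a

theorem sum_le_sum_of_pair {ι : Type*} [Fintype ι] [DecidableEq ι] {f g : ι → ℕ} {j k : ι}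
    (hjk : j ≠ k) (hpair : f k + f j ≤ g k + g j) (h : ∀ i, i ≠ k → i ≠ j → f i ≤ g i) :
    ∑ i, f i ≤ ∑ i, g i := by
  have hj : j ∈ Finset.univ.erase k := by simp [hjk]
  rw [← Finset.add_sum_erase _ f (Finset.mem_univ k), ← Finset.add_sum_erase _ f hj,
    ← Finset.add_sum_erase _ g (Finset.mem_univ k), ← Finset.add_sum_erase _ g hj]
  have : ∑ i ∈ (Finset.univ.erase k).erase j, f i ≤ ∑ i ∈ (Finset.univ.erase k).erase j, g i :=
    Finset.sum_le_sum fun i hi => by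
      simp only [Finset.mem_erase, Finset.mem_univ, and_true] at hi
      exact h i hi.2 hi.1
  omega

-- STATEMENT 12
theorem stmt12 (m n : ℕ) (hm : 2 ≤ m) (l : Fin m → ℕ) (hpos : ∀ i, 1 ≤ l i)
    (hsum : ∑ i, l i = n) (k j : Fin m) (hjk : j ≠ k)
    (hmax : ∀ i, l i ≤ l k) (hgap : l j + 2 ≤ l k) :
    totalEcc (Kmn m (Function.update (Function.update l k (l k - 1)) j (l j + 1)))
      ≤ totalEcc (Kmn m l) := by
  set l' := Function.update (Function.update l k (l k - 1)) j (l j + 1) with hl'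
  have hj : l' j = l j + 1 := by simp [hl']
  have hk : l' k = l k - 1 := by simp [hl', hjk.symm]
  have ho : ∀ i, i ≠ k → i ≠ j → l' i = l i := fun i h1 h2 => by simp [hl', h1, h2]
  have hpos' : ∀ i, 1 ≤ l' i := by
    intro i
    by_cases h1 : i = k
    · subst h1; omega
    by_cases h2 : i = j
    · subst h2; omega
    · rw [ho i h1 h2]; exact hpos i
  rw [totalEcc_kmn hm hpos, totalEcc_kmn hm hpos']
  have hM : ∀ i, i ≠ k → l k ≤ otherMax l i := fun i hi => le_otherMax l hi.symm
  obtain ⟨L, hL⟩ : ∃ L, l k = L + 1 := ⟨l k - 1, by omega⟩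
  have hk' : l' k = L := by omega
  rcases lt_or_ge (otherMax l k) (l k) with hs | hs
  · have hle : ∀ i, l' i ≤ L := by
      intro i
      by_cases h1 : i = k
      · subst h1; omega
      by_cases h2 : i = j
      · subst h2; omega
      · have := le_otherMax l h1
        rw [ho i h1 h2]; omega
    have hM' : ∀ i, otherMax l' i ≤ L := fun i => otherMax_le fun i' _ => hle i'
    have hMk : otherMax l' k ≤ otherMax l k + 1 := otherMax_le fun i hi => by
      have := le_otherMax l hi
      by_cases h2 : i = j
      · subst h2; omega
      · rw [ho i hi h2]; omega
    refine sum_le_sum_of_pair hjk ?_ fun i h1 h2 => ?_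
    · rw [hk', hj, hL, Finset.sum_range_succ' (kmnEcc l' j), Finset.sum_range_succ' (kmnEcc l k)]
      have e1 : ∑ a ∈ Finset.range L, kmnEcc l' k a ≤
          ∑ a ∈ Finset.range L, kmnEcc l k (a + 1) :=
        Finset.sum_le_sum fun a _ => by unfold kmnEcc; omega
      have e2 : ∑ a ∈ Finset.range (l j), kmnEcc l' j (a + 1) ≤
          ∑ a ∈ Finset.range (l j), kmnEcc l j a :=
        Finset.sum_le_sum fun a _ => by
          have := hM j hjk
          have := hM' j
          unfold kmnEcc; omega
      have e3 : kmnEcc l' j 0 ≤ kmnEcc l k 0 := by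
        have := hM' j
        unfold kmnEcc; omega
      omega
    · rw [ho i h1 h2]
      refine Finset.sum_le_sum fun a _ => ?_
      have := hM i h1
      have := hM' i
      have := hle i
      unfold kmnEcc; omega
  · have hle : ∀ i, l' i ≤ l k := by
      intro i
      by_cases h1 : i = k
      · subst h1; omega
      by_cases h2 : i = j
      · subst h2; omega
      · rw [ho i h1 h2]; exact hmax i
    have hbound : ∀ i i' a b, a ≤ b → kmnEcc l' i a ≤ kmnEcc l i' b := by
      intro i i' a b hab
      have h1 : otherMax l' i ≤ l k := otherMax_le fun i' _ => hle i'
      have h2 : l k ≤ otherMax l i' := by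
        by_cases h : i' = k
        · rwa [h]
        · exact hM i' h
      have := hle i
      unfold kmnEcc; omega
    refine sum_le_sum_of_pair hjk ?_ fun i h1 h2 => ?_
    · rw [hk', hj, hL, Finset.sum_range_succ (kmnEcc l' j), Finset.sum_range_succ (kmnEcc l k)]
      have e1 := Finset.sum_le_sum fun a (_ : a ∈ Finset.range L) => hbound k k a a le_rfl
      have e2 := Finset.sum_le_sum fun a (_ : a ∈ Finset.range (l j)) => hbound j j a a le_rfl
      have e3 := hbound j k (l j) L (by omega)
      omega
    · rw [ho i h1 h2]
      exact Finset.sum_le_sum fun a _ => hbound i i a a le_rfl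
end
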